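/- arXiv:2310.18032 — 2 statements merged into one kernel-verified Lean document; each statement's English description precedes it below -/
import Mathlib

section
/- Let R be a commutative ring with identity, S a multiplicative subset of R, n a positive integer, and I an ideal of R all of whose minimal prime ideals are disjoint from S. Suppose I is an S-n-absorbing ideal of R having exactly n minimal prime ideals P_1, …, P_n. Then there exists s ∈ S such that s·P_1⋯P_n ⊆ I; moreover, n is the least positive integer m such that I is an S-m-absorbing ideal of R. -/
/-- `I` is `S`-`n`-absorbing with associated element `s`. -/
def IsSNAbsorbingAssoc {R : Type*} [CommRing R] (s : R) (n : ℕ) (I : Ideal R) : Prop :=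
  ∀ r : Fin (n + 1) → R, (∏ i, r i) ∈ I →
    ∃ j : Fin (n + 1), s * ∏ i ∈ Finset.univ.erase j, r i ∈ I

/-- `I` is an `S`-`n`-absorbing ideal. -/
def IsSNAbsorbing {R : Type*} [CommRing R] (S : Set R) (n : ℕ) (I : Ideal R) : Prop :=
  ∃ s ∈ S, IsSNAbsorbingAssoc s n I

theorem aux_step {R : Type*} [CommRing R] (n : ℕ) (I : Ideal R) (s : R)
    (hs : IsSNAbsorbingAssoc s n I) (P : Fin n → Ideal R) (hp : ∀ i, (P i).IsPrime)
    (hIP : ∀ i, I ≤ P i) (hsP : ∀ i, s ∉ P i) (z : Fin n → R)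
    (hz : ∀ i j, z i ∈ P j ↔ i = j) :
    ∀ (L : Multiset (Fin n)) (u : R), (∀ i, u ∉ P i) →
      u * (L.map z).prod * ∏ i, z i ∈ I → s * ∏ i, z i ∈ I := by
  intro L
  induction hL : L.card generalizing L with
  | zero =>
    intro u hu h
    obtain rfl := Multiset.card_eq_zero.mp hL
    obtain ⟨j, hj⟩ := hs (Fin.cons u z) (by simpa [Fin.prod_univ_succ] using h)
    rcases Fin.eq_zero_or_eq_succ j with rfl | ⟨i, rfl⟩
    · have e : (Finset.univ.erase (0 : Fin (n+1))) = Finset.univ.map (Fin.succEmb n) := by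
        ext x; rcases Fin.eq_zero_or_eq_succ x with rfl | ⟨i, rfl⟩ <;> simp
      simpa [e] using hj
    · exfalso
      have := hp i
      rcases (hp i).mem_or_mem (hIP i hj) with h1 | h1
      · exact hsP i h1
      · obtain ⟨x, hx, h2⟩ := (Ideal.IsPrime.prod_mem_iff).mp h1
        rcases Fin.eq_zero_or_eq_succ x with rfl | ⟨k, rfl⟩
        · exact hu i (by simpa using h2)
        · simp at hx h2
          exact hx ((hz _ _).mp h2)
  | succ m ih =>
    intro u hu h
    obtain ⟨j, hj⟩ := hs (Fin.cons (u * (L.map z).prod) z)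
      (by simpa [Fin.prod_univ_succ] using h)
    rcases Fin.eq_zero_or_eq_succ j with rfl | ⟨i, rfl⟩
    · have e : (Finset.univ.erase (0 : Fin (n+1))) = Finset.univ.map (Fin.succEmb n) := by
        ext x; rcases Fin.eq_zero_or_eq_succ x with rfl | ⟨i, rfl⟩ <;> simp
      simpa [e] using hj
    · have := hp i
      have e : (Finset.univ.erase (Fin.succ i)) =
          insert 0 ((Finset.univ.erase i).map (Fin.succEmb n)) := by
        ext x; rcases Fin.eq_zero_or_eq_succ x with rfl | ⟨i, rfl⟩
        · simp [(Fin.succ_ne_zero _).symm]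
        · simp
      rw [e, Finset.prod_insert (by simp)] at hj
      simp only [Fin.cons_zero, Finset.prod_map, Fin.coe_succEmb, Fin.cons_succ] at hj
      have hiL : i ∈ L := by
        have hj' := hIP i hj
        rw [(hp i).mul_mem_iff_mem_or_mem, (hp i).mul_mem_iff_mem_or_mem,
          (hp i).mul_mem_iff_mem_or_mem] at hj'
        rcases hj' with h1 | (h1 | h1) | h1
        · exact (hsP i h1).elim
        · exact (hu i h1).elim
        · rw [Ideal.IsPrime.multiset_prod_mem_iff_exists_mem (hp i)] at h1
          obtain ⟨y, hy, h2⟩ := h1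
          obtain ⟨k, hk, rfl⟩ := Multiset.mem_map.mp hy
          rwa [← (hz _ _).mp h2]
        · obtain ⟨x, hx, h2⟩ := (Ideal.IsPrime.prod_mem_iff).mp h1
          exact ((Finset.mem_erase.mp hx).1 ((hz _ _).mp h2)).elim
      refine ih (L.erase i) (by simp [Multiset.card_erase_of_mem hiL, hL]) (s * u) ?_ ?_
      · intro k hk
        rcases (hp k).mem_or_mem hk with h1 | h1
        · exact hsP k h1
        · exact hu k h1
      · rw [← Multiset.prod_map_erase hiL] at hj
        rw [← Finset.mul_prod_erase Finset.univ z (Finset.mem_univ i)]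
        convert hj using 1
        ring

theorem stmt_16 {R : Type*} [CommRing R] (S : Submonoid R) (n : ℕ) (hn : 0 < n)
    (I : Ideal R)
    (hminS : ∀ P ∈ I.minimalPrimes, Disjoint (P : Set R) (S : Set R))
    (hI : IsSNAbsorbing (S : Set R) n I)
    (P : Fin n → Ideal R) (hPinj : Function.Injective P)
    (hmin : I.minimalPrimes = Set.range P) :
    (∃ s ∈ S, ∀ x ∈ (∏ i, P i : Ideal R), s * x ∈ I) ∧
      (∀ m : ℕ, 0 < m → IsSNAbsorbing (S : Set R) m I → n ≤ m) := by
  have hPm : ∀ i, P i ∈ I.minimalPrimes := fun i => hmin ▸ ⟨i, rfl⟩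
  have hp : ∀ i, (P i).IsPrime := fun i => (hPm i).1.1
  have hIP : ∀ i, I ≤ P i := fun i => (hPm i).1.2
  have hSP : ∀ s ∈ S, ∀ i, s ∉ P i := fun s hs i h =>
    Set.disjoint_left.mp (hminS _ (hPm i)) h hs
  have hle : ∀ i j, P i ≤ P j → i = j := fun i j h =>
    hPinj (le_antisymm h ((hPm j).2 (hPm i).1 h))
  have hrad : ∀ x, (∀ i, x ∈ P i) → ∃ k, x ^ k ∈ I := by
    intro x hx
    have : x ∈ I.radical := by
      rw [← Ideal.sInf_minimalPrimes, hmin, Ideal.mem_sInf]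
      rintro _ ⟨i, rfl⟩
      exact hx i
    exact this
  let E : Fin n → Set R := fun i => {x | ∀ j, x ∈ P j ↔ i = j}
  have hE : ∀ i, (E i).Nonempty := by
    intro i
    by_contra hne
    have hsub : (P i : Set R) ⊆ ⋃ j ∈ (↑(Finset.univ.erase i) : Set (Fin n)), (P j : Set R) := by
      intro x hx
      by_contra hx2
      simp only [Set.mem_iUnion, not_exists] at hx2
      refine hne ⟨x, fun j => ⟨fun h => ?_, fun h => h ▸ hx⟩⟩
      by_contra hij
      exact hx2 j (by simpa using Ne.symm hij) h
    obtain ⟨j, hj, h⟩ := (Ideal.subset_union_prime i i (fun j _ _ _ => hp j)).mp hsub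
    exact (Finset.mem_erase.mp hj).1 (hle i j h).symm
  have hspan : ∀ i, P i ≤ Ideal.span (E i) := by
    intro i
    have hsub : (P i : Set R) ⊆ ⋃ j ∈ (↑(Finset.univ : Finset (Fin n)) : Set (Fin n)),
        (Function.update P i (Ideal.span (E i)) j : Set R) := by
      intro x hx
      by_cases hxE : x ∈ E i
      · simp only [Set.mem_iUnion]
        exact ⟨i, by simp, by simpa using Ideal.subset_span hxE⟩
      · have : ∃ j, x ∈ P j ∧ i ≠ j := by
          by_contra hc
          push Not at hc
          exact hxE fun j => ⟨hc j, fun h => h ▸ hx⟩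
        obtain ⟨j, hj, hij⟩ := this
        simp only [Set.mem_iUnion]
        exact ⟨j, by simp, by simpa [Function.update_of_ne hij.symm] using hj⟩
    obtain ⟨j, -, h⟩ := (Ideal.subset_union_prime i i (fun j _ hj _ => by
      simpa [Function.update_of_ne hj] using hp j)).mp hsub
    by_cases hij : j = i
    · subst hij; simpa using h
    · rw [Function.update_of_ne hij] at h
      exact (hij (hle i j h).symm).elim
  constructor
  · obtain ⟨s, hsS, hs⟩ := hI
    refine ⟨s, hsS, fun x hx => ?_⟩
    have h1 : (∏ i, P i) ≤ ∏ i, Ideal.span (E i) :=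
      Finset.prod_le_prod' fun i _ => hspan i
    replace hx := h1 hx
    clear h1
    rw [Ideal.prod_span] at hx
    induction hx using Submodule.span_induction with
    | mem x hx =>
      obtain ⟨z, hz, rfl⟩ := Set.mem_fintype_prod _ _ |>.mp hx
      obtain ⟨k, hk⟩ := hrad (∏ i, z i) fun i =>
        Ideal.mem_of_dvd _ (Finset.dvd_prod_of_mem z (Finset.mem_univ i)) ((hz i i).mpr rfl)
      refine aux_step n I s hs P hp hIP (hSP s hsS) z (fun i j => hz i j)
        (k • Finset.univ.val) 1 (hSP 1 S.one_mem) ?_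
      rw [Multiset.map_nsmul, Multiset.prod_nsmul, one_mul]
      exact I.mul_mem_right _ hk
    | zero => simp
    | add x y _ _ hx hy => rw [mul_add]; exact I.add_mem hx hy
    | smul a x _ hx =>
      rw [smul_eq_mul, mul_left_comm]; exact I.mul_mem_left _ hx
  · rintro m hm ⟨s, hsS, hs⟩
    by_contra! hlt
    choose z hz using hE
    obtain ⟨k, hk⟩ := hrad (∏ i, z i) fun i =>
      Ideal.mem_of_dvd _ (Finset.dvd_prod_of_mem z (Finset.mem_univ i)) ((hz i i).mpr rfl)
    let f : Fin n → Fin (m + 1) := fun i => ⟨min i m, by omega⟩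
    obtain ⟨j, hj⟩ := hs (fun a => ∏ i with f i = a, z i ^ k) (by
      rw [Finset.prod_fiberwise, Finset.prod_pow]; exact hk)
    let i : Fin n := ⟨j, by omega⟩
    have hfi : f i = j := by ext; simp [f, i]; omega
    have := hp i
    rcases (hp i).mem_or_mem (hIP i hj) with h1 | h1
    · exact hSP s hsS i h1
    · obtain ⟨a, ha, h2⟩ := (Ideal.IsPrime.prod_mem_iff).mp h1
      obtain ⟨b, hb, h3⟩ := (Ideal.IsPrime.prod_mem_iff).mp h2
      have := (hz b i).mp ((hp i).mem_of_pow_mem _ h3)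
      subst this
      simp only [Finset.mem_filter] at hb
      exact (Finset.mem_erase.mp ha).1 (hb.2.symm.trans hfi)
end

section
/- Let R be a commutative ring with identity and S a multiplicative subset of R. Suppose R is strongly S-Laskerian, i.e., every proper ideal of R disjoint from S can be written as an intersection of finitely many strongly S-primary ideals of R. Then for every ideal I of R with I ∩ S = ∅ there exists a positive integer n such that I is an S-n-absorbing ideal of R. Moreover, if R is locally divided and every ideal of R disjoint from S is S-n-absorbing for some positive integer n, then R is strongly S-Laskerian. -/
/-- `Q` is an `S`-primary ideal. -/
def IsSPrimary {R : Type*} [CommRing R] (S : Set R) (Q : Ideal R) : Prop :=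
  Disjoint (Q : Set R) S ∧
    ∃ s ∈ S, ∀ a b : R, a * b ∈ Q → s * a ∈ Q ∨ s * b ∈ Q.radical

/-- `Q` is a strongly `S`-primary ideal: `Q` is `S`-primary and `t ⋅ (√Q)^m ⊆ Q` for
some positive integer `m` and some `t ∈ S`. -/
def IsStronglySPrimary {R : Type*} [CommRing R] (S : Set R) (Q : Ideal R) : Prop :=
  IsSPrimary S Q ∧
    ∃ (m : ℕ) (t : R), 0 < m ∧ t ∈ S ∧ ∀ x ∈ (Q.radical ^ m : Ideal R), t * x ∈ Q

/-- `R` is strongly `S`-Laskerian: every proper ideal disjoint from `S` is a finite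
intersection of strongly `S`-primary ideals. -/
def IsStronglySLaskerian (R : Type*) [CommRing R] (S : Set R) : Prop :=
  ∀ J : Ideal R, J ≠ ⊤ → Disjoint (J : Set R) S →
    ∃ (m : ℕ) (Q : Fin m → Ideal R), (∀ i, IsStronglySPrimary S (Q i)) ∧ J = ⨅ i, Q i

/-- A commutative ring is divided if for every prime `P` and every element `a`,
either `a ∈ P` or `P ⊆ aT`. -/
def IsDividedRing (T : Type*) [CommRing T] : Prop :=
  ∀ P : Ideal T, P.IsPrime → ∀ a : T, a ∈ P ∨ P ≤ Ideal.span {a}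

/-- `R` is locally divided if its localization at every maximal ideal is divided. -/
def IsLocallyDivided (R : Type*) [CommRing R] : Prop :=
  ∀ (M : Ideal R) (hM : M.IsMaximal),
    haveI : M.IsPrime := hM.isPrime
    IsDividedRing (Localization.AtPrime M)

namespace SLask

open Finset

variable {R : Type*} [CommRing R]

/-- Finset form of the absorbing property. -/
theorem absorb_finset {s : R} {n : ℕ} {I : Ideal R} (h : IsSNAbsorbingAssoc s n I)
    {ι : Type*} [DecidableEq ι] (t : Finset ι) (ht : t.card = n) (f : ι → R) (c : R)
    (hc : c * ∏ i ∈ t, f i ∈ I) :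
    s * ∏ i ∈ t, f i ∈ I ∨ ∃ k ∈ t, s * (c * ∏ i ∈ t.erase k, f i) ∈ I := by
  classical
  let e : Fin n ≃ t := (Fin.castOrderIso ht.symm).toEquiv.trans t.equivFin.symm
  have hprod : ∏ i : Fin n, f (e i) = ∏ i ∈ t, f i := by
    rw [← Finset.prod_coe_sort t f]
    exact Equiv.prod_comp e (fun i => f (i : ι))
  obtain ⟨j, hj⟩ := h (Fin.cons c (fun i => f (e i))) (by
    rw [Fin.prod_univ_succ]; simpa [hprod] using hc)
  induction j using Fin.cases with
  | zero =>
    left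
    have : (univ.erase (0 : Fin (n+1))) = univ.map (Fin.succEmb n) := by
      ext x; simp [Fin.exists_succ_eq]
    rw [this, Finset.prod_map] at hj
    simpa [hprod] using hj
  | succ j =>
    right
    refine ⟨e j, (e j).2, ?_⟩
    have h1 : (univ.erase (j.succ : Fin (n+1))) =
        insert 0 ((univ.erase j).map (Fin.succEmb n)) := by
      ext x
      induction x using Fin.cases <;> simp [Fin.succ_ne_zero, (Fin.succ_ne_zero _).symm]
    have h2 : t.erase (e j : ι) =
        (univ.erase j).map (e.toEmbedding.trans (Function.Embedding.subtype _)) := by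
      ext x
      simp only [mem_erase, mem_map, mem_univ, and_true, Function.Embedding.trans_apply,
        Equiv.coe_toEmbedding, Function.Embedding.coe_subtype]
      constructor
      · rintro ⟨h3, h4⟩
        refine ⟨e.symm ⟨x, h4⟩, ?_, by simp⟩
        rintro rfl
        simp at h3
      · rintro ⟨a, h3, rfl⟩
        exact ⟨fun h4 => h3 (e.injective (Subtype.ext h4)), (e a).2⟩
    rw [h1, Finset.prod_insert (by simp [Fin.succ_ne_zero]), Finset.prod_map] at hj
    rw [h2, Finset.prod_map]
    simpa using hj

/-- Reduction to subfamilies of size at most `n`. -/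
theorem absorb_subset {n : ℕ} {I : Ideal R} (h : IsSNAbsorbingAssoc 1 n I)
    {ι : Type*} [DecidableEq ι] (f : ι → R) (N : ℕ) : ∀ (t : Finset ι), t.card = N →
    ∏ i ∈ t, f i ∈ I → ∃ t' ⊆ t, t'.card ≤ n ∧ ∏ i ∈ t', f i ∈ I := by
  induction N with
  | zero => intro t ht hp; exact ⟨t, Subset.rfl, by omega, hp⟩
  | succ N ih =>
    intro t ht hp
    by_cases hn : t.card ≤ n
    · exact ⟨t, Subset.rfl, hn, hp⟩
    obtain ⟨u, hu, huc⟩ := Finset.exists_subset_card_eq (s := t) (n := n) (by omega)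
    rw [← Finset.prod_sdiff hu] at hp
    rcases absorb_finset h u huc f _ hp with h1 | ⟨k, hk, h1⟩
    · exact ⟨u, hu, huc.le, by simpa using h1⟩
    · have h2 : ∏ i ∈ t.erase k, f i ∈ I := by
        have h3 : u.erase k ⊆ t.erase k := Finset.erase_subset_erase _ hu
        rw [← Finset.prod_sdiff h3]
        have h4 : t.erase k \ u.erase k = t \ u := by
          ext x; simp only [mem_sdiff, mem_erase]
          constructor
          · rintro ⟨⟨a, b⟩, c⟩; exact ⟨b, fun d => c ⟨a, d⟩⟩
          · rintro ⟨a, b⟩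
            exact ⟨⟨fun e => b (e ▸ hk), a⟩, fun d => b d.2⟩
        rw [h4]; simpa using h1
      obtain ⟨t', a, b, c⟩ := ih (t.erase k) (by rw [Finset.card_erase_of_mem (hu hk)]; omega) h2
      exact ⟨t', a.trans (Finset.erase_subset _ _), b, c⟩

/-- Independent sets in digraphs of bounded out-degree. -/
theorem exists_indep {ι : Type*} [DecidableEq ι] (D : ι → Finset ι) (d : ℕ)
    (hD : ∀ i, (D i).card ≤ d) (n : ℕ) : ∀ V : Finset ι, n * (2 * d + 1) ≤ V.card →
    ∃ A ⊆ V, A.card = n ∧ ∀ i ∈ A, ∀ j ∈ A, i ≠ j → j ∉ D i := by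
  induction n with
  | zero => intro V _; exact ⟨∅, by simp, by simp, by simp⟩
  | succ n ih =>
    intro V hV
    have hVpos : 0 < V.card := lt_of_lt_of_le (by positivity) hV
    obtain ⟨v, hv, hvd⟩ : ∃ v ∈ V, (V.filter (fun i => v ∈ D i)).card ≤ d := by
      by_contra! hcon
      have h1 : ∑ a ∈ V, (V.bipartiteAbove (fun a b => b ∈ D a) a).card =
          ∑ b ∈ V, (V.bipartiteBelow (fun a b => b ∈ D a) b).card :=
        sum_card_bipartiteAbove_eq_sum_card_bipartiteBelow _
      have h2 : ∑ a ∈ V, (V.bipartiteAbove (fun a b => b ∈ D a) a).card ≤ ∑ a ∈ V, d := by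
        refine Finset.sum_le_sum fun a _ => (Finset.card_le_card ?_).trans (hD a)
        intro x hx
        simp only [bipartiteAbove, mem_filter] at hx
        exact hx.2
      have h3 : ∑ a ∈ V, d < ∑ b ∈ V, (V.bipartiteBelow (fun a b => b ∈ D a) b).card :=
        Finset.sum_lt_sum_of_nonempty (Finset.card_pos.mp hVpos) (fun b hb => hcon b hb)
      omega
    let W := V \ (insert v (D v ∪ V.filter (fun i => v ∈ D i)))
    have hW : n * (2 * d + 1) ≤ W.card := by
      have h1 : V.card - (insert v (D v ∪ V.filter (fun i => v ∈ D i))).card ≤ W.card :=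
        Finset.le_card_sdiff _ _
      have h2 := Finset.card_insert_le v (D v ∪ V.filter (fun i => v ∈ D i))
      have h3 := Finset.card_union_le (D v) (V.filter (fun i => v ∈ D i))
      have h4 := hD v
      have h5 : (n + 1) * (2 * d + 1) = n * (2 * d + 1) + (2 * d + 1) := by ring
      omega
    obtain ⟨A, hA, hAc, hAi⟩ := ih W hW
    have hAW : ∀ x ∈ A, x ∈ V ∧ x ≠ v ∧ x ∉ D v ∧ v ∉ D x := by
      intro x hx
      have := hA hx
      simp only [W, mem_sdiff, mem_insert, mem_union, mem_filter, not_or, not_and] at this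
      exact ⟨this.1, this.2.1, this.2.2.1, this.2.2.2 this.1⟩
    refine ⟨insert v A, ?_, ?_, ?_⟩
    · intro x hx
      rcases Finset.mem_insert.mp hx with rfl | hx
      · exact hv
      · exact (hAW x hx).1
    · rw [Finset.card_insert_of_notMem (fun h => (hAW v h).2.1 rfl), hAc]
    · intro i hi j hj hij
      rcases Finset.mem_insert.mp hi with hiv | hiA
      · subst hiv
        rcases Finset.mem_insert.mp hj with hjv | hjA
        · exact absurd hjv.symm hij
        · exact (hAW j hjA).2.2.1
      · rcases Finset.mem_insert.mp hj with hjv | hjA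
        · subst hjv
          exact (hAW i hiA).2.2.2
        · exact hAi i hiA j hjA hij

/-- If `I` is `n`-absorbing, long products of elements of its radical lie in `I`. -/
theorem prod_mem_of_radical {n : ℕ} {I : Ideal R} (h : IsSNAbsorbingAssoc 1 n I)
    (x : Fin (n * (2 * n + 1)) → R) (hx : ∀ i, x i ∈ I.radical) : ∏ i, x i ∈ I := by
  classical
  by_contra hnot
  choose K hK using hx
  let E : Set (Fin (n * (2 * n + 1)) → ℕ) := {a | ∏ i, x i ^ a i ∉ I}
  have hEfin : E.Finite := by
    refine (Set.finite_Iic K).subset ?_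
    intro a ha
    rw [Set.mem_Iic]
    by_contra hcon
    rw [Pi.le_def] at hcon
    push Not at hcon
    obtain ⟨i, hi⟩ := hcon
    refine ha (I.mem_of_dvd (Finset.dvd_prod_of_mem _ (Finset.mem_univ i)) ?_)
    exact I.mem_of_dvd (pow_dvd_pow _ hi.le) (hK i)
  have h1E : (fun _ => 1) ∈ E := by simpa [E] using hnot
  obtain ⟨a, ha1, haM⟩ := hEfin.exists_le_maximal h1E
  have haE : ∏ i, x i ^ a i ∉ I := haM.1
  set y : Fin (n * (2 * n + 1)) → R := fun i => x i ^ a i with hy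
  have hyy : ∀ i, y i * ∏ j, y j ∈ I := by
    intro i
    have h1 : Function.update a i (a i + 1) ∉ E := by
      intro hmem
      have h2 := haM.2 hmem (by
        intro j
        by_cases hj : j = i
        · subst hj; simp
        · simp [hj])
      have := h2 i
      simp at this
    have h2 : ∏ j, x j ^ (Function.update a i (a i + 1)) j ∈ I := by
      by_contra h3; exact h1 h3
    have h3 : ∏ j, x j ^ (Function.update a i (a i + 1)) j = x i * ∏ j, y j := by
      rw [← Finset.mul_prod_erase _ _ (mem_univ i), ← Finset.mul_prod_erase univ y (mem_univ i)]
      have : ∏ j ∈ univ.erase i, x j ^ (Function.update a i (a i + 1)) j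
          = ∏ j ∈ univ.erase i, y j := by
        refine Finset.prod_congr rfl fun j hj => ?_
        simp [y, Finset.ne_of_mem_erase hj]
      rw [this]
      simp [y, pow_succ]; ring
    rw [h3] at h2
    have h4 : x i ∣ y i := dvd_pow_self _ (by have := ha1 i; simp at this; omega)
    exact I.mem_of_dvd (mul_dvd_mul_right h4 _) h2
  have hDex : ∀ i, ∃ D : Finset (Fin (n * (2 * n + 1))), D.card ≤ n ∧ i ∉ D ∧
      y i ^ 2 * ∏ j ∈ D, y j ∈ I := by
    intro i
    have h1 : ∏ j ∈ univ, (Function.update y i (y i ^ 2)) j ∈ I := by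
      have h2 := hyy i
      rw [← Finset.mul_prod_erase univ y (mem_univ i)] at h2
      rw [← Finset.mul_prod_erase _ _ (mem_univ i)]
      have : ∏ j ∈ univ.erase i, (Function.update y i (y i ^ 2)) j
          = ∏ j ∈ univ.erase i, y j := by
        refine Finset.prod_congr rfl fun j hj => ?_
        simp [Finset.ne_of_mem_erase hj]
      rw [this, Function.update_self, pow_two, mul_assoc]
      exact h2
    obtain ⟨t, -, htc, htp⟩ := absorb_subset h _ _ univ rfl h1
    by_cases hit : i ∈ t
    · refine ⟨t.erase i, (Finset.card_le_card (Finset.erase_subset _ _)).trans htc, by simp, ?_⟩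
      rw [← Finset.mul_prod_erase _ _ hit] at htp
      have : ∏ j ∈ t.erase i, (Function.update y i (y i ^ 2)) j
          = ∏ j ∈ t.erase i, y j := by
        refine Finset.prod_congr rfl fun j hj => ?_
        simp [Finset.ne_of_mem_erase hj]
      rw [this, Function.update_self] at htp
      exact htp
    · exfalso
      have : ∏ j ∈ t, (Function.update y i (y i ^ 2)) j = ∏ j ∈ t, y j := by
        refine Finset.prod_congr rfl fun j hj => ?_
        have : j ≠ i := fun e => hit (e ▸ hj)
        simp [this]
      rw [this] at htp
      exact haE (I.mem_of_dvd (Finset.prod_dvd_prod_of_subset _ _ _ (subset_univ t)) htp)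
  choose D hDc hDi hDp using hDex
  obtain ⟨A, -, hAc, hAi⟩ := exists_indep D n hDc n univ (by simp)
  set w := ∏ j ∈ univ \ A, y j with hw
  have hwA : w * ∏ j ∈ A, y j = ∏ j, y j := Finset.prod_sdiff (subset_univ A)
  have hwy : ∀ i ∈ A, w * y i ^ 2 ∈ I := by
    intro i hi
    have : D i ⊆ univ \ A := by
      intro j hj
      simp only [mem_sdiff, mem_univ, true_and]
      intro hjA
      by_cases hij : i = j
      · subst hij; exact hDi i hj
      · exact hAi i hi j hjA hij hj
    rw [mul_comm]
    exact I.mem_of_dvd (mul_dvd_mul_left _ (Finset.prod_dvd_prod_of_subset _ _ _ this)) (hDp i)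
  have hmain : (w * ∑ i ∈ A, y i) * ∏ j ∈ A, y j ∈ I := by
    have : (w * ∑ i ∈ A, y i) * ∏ j ∈ A, y j = ∑ i ∈ A, y i * ∏ j, y j := by
      rw [← Finset.sum_mul, ← hwA]; ring
    rw [this]
    exact I.sum_mem fun i _ => hyy i
  rcases absorb_finset h A hAc y _ hmain with h1 | ⟨k, hk, h1⟩
  · apply haE
    change ∏ j, y j ∈ I
    rw [← hwA]
    exact I.mul_mem_left _ (by simpa using h1)
  · apply haE
    change ∏ j, y j ∈ I
    have h2 : w * (∑ i ∈ A.erase k, y i) * ∏ j ∈ A.erase k, y j ∈ I := by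
      rw [Finset.mul_sum, Finset.sum_mul]
      refine I.sum_mem fun i hi => ?_
      rw [← Finset.mul_prod_erase _ _ hi, ← mul_assoc, mul_assoc w, ← pow_two]
      exact I.mul_mem_right _ (hwy i (Finset.mem_of_mem_erase hi))
    have h3 : ∏ j, y j = 1 * (w * ∑ i ∈ A, y i * 1) * ∏ j ∈ A.erase k, y j
        - w * (∑ i ∈ A.erase k, y i) * ∏ j ∈ A.erase k, y j := by
      rw [← hwA, ← Finset.mul_prod_erase A y hk]
      simp only [mul_one]
      rw [← Finset.add_sum_erase A y hk]
      ring
    rw [h3]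
    refine I.sub_mem ?_ h2
    simpa [mul_assoc] using h1

theorem mul_mem_of_mem_pow {I J : Ideal R} (N : ℕ) : ∀ c : R,
    (∀ f : Fin N → R, (∀ i, f i ∈ I) → c * ∏ i, f i ∈ J) → ∀ x ∈ I ^ N, c * x ∈ J := by
  induction N with
  | zero =>
    intro c h x _
    have := h Fin.elim0 (fun i => i.elim0)
    exact J.mem_of_dvd (by simp) this
  | succ N ih =>
    intro c h x hx
    rw [pow_succ'] at hx
    refine Submodule.mul_induction_on hx ?_ ?_
    · intro a ha b hb
      rw [← mul_assoc]
      refine ih (c * a) ?_ b hb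
      intro f hf
      have := h (Fin.cons a f) (by
        intro i
        induction i using Fin.cases with
        | zero => simpa using ha
        | succ i => simpa using hf i)
      rw [Fin.prod_univ_succ] at this
      simpa [mul_assoc] using this
    · intro a b ha hb
      rw [mul_add]; exact J.add_mem ha hb

theorem radical_pow_le {n : ℕ} {I : Ideal R} (h : IsSNAbsorbingAssoc 1 n I) :
    ∃ m : ℕ, 0 < m ∧ I.radical ^ m ≤ I := by
  refine ⟨n * (2 * n + 1) + 1, by omega, (Ideal.pow_le_pow_right (Nat.le_succ _)).trans ?_⟩
  intro x hx
  have := mul_mem_of_mem_pow (J := I) _ 1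
    (fun f hf => by simpa using prod_mem_of_radical h f hf) x hx
  simpa using this

theorem minimalPrime_pow {I P : Ideal R} (hP : P ∈ I.minimalPrimes) {x : R} (hx : x ∈ P) :
    ∃ k : ℕ, ∃ u, u ∉ P ∧ u * x ^ k ∈ I := by
  have := hP.1.1
  by_contra! hcon
  let T : Submonoid R := P.primeCompl ⊔ Submonoid.powers x
  have hd : Disjoint (I : Set R) (T : Set R) := by
    rw [Set.disjoint_left]
    intro z hz hzT
    obtain ⟨u, hu, v, ⟨k, rfl⟩, rfl⟩ := Submonoid.mem_sup.mp hzT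
    exact hcon k u hu hz
  obtain ⟨q, hq, hIq, hqT⟩ := Ideal.exists_le_prime_disjoint I T hd
  have hqP : q ≤ P := by
    intro z hz
    by_contra hzP
    exact Set.disjoint_left.mp hqT hz
      ((le_sup_left : P.primeCompl ≤ T) (show z ∈ P.primeCompl from hzP))
  have := hP.2 ⟨hq, hIq⟩ hqP
  exact Set.disjoint_left.mp hqT (this hx)
    ((le_sup_right : Submonoid.powers x ≤ T) (Submonoid.mem_powers x))

theorem avoid (F : Finset (Ideal R)) (hF : ∀ P ∈ F, P.IsPrime) (I : Ideal R)
    (h : ∀ P ∈ F, ¬ I ≤ P) : ∃ x ∈ I, ∀ P ∈ F, x ∉ P := by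
  by_contra! hcon
  have : (I : Set R) ⊆ ⋃ i ∈ (↑F : Set (Ideal R)), (i : Set R) := by
    intro x hx
    obtain ⟨P, hP, hxP⟩ := hcon x hx
    simp only [Set.mem_iUnion]
    exact ⟨P, hP, hxP⟩
  obtain ⟨P, hP, hIP⟩ :=
    (Ideal.subset_union_prime (f := id) ⊥ ⊥ (fun i hi _ _ => hF i hi)).mp this
  exact h P hP hIP

theorem finite_minimalPrimes {n : ℕ} {I : Ideal R} (h : IsSNAbsorbingAssoc 1 n I) :
    I.minimalPrimes.Finite := by
  classical
  by_contra hinf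
  obtain ⟨F, hFI, hFc⟩ := Set.Infinite.exists_subset_card_eq hinf (n + 1)
  have hFp : ∀ P ∈ F, P.IsPrime := fun P hP => (hFI hP).1.1
  have hx : ∀ P : Ideal R, ∃ x, P ∈ F → x ∈ P ∧ (∀ P' ∈ F, P' ≠ P → x ∉ P') ∧
      ∃ u, u ∉ P ∧ u * x ∈ I := by
    intro P
    by_cases hP : P ∈ F
    · obtain ⟨x, hxP, hx⟩ := avoid (F.erase P)
        (fun P' hP' => hFp P' (Finset.mem_of_mem_erase hP')) P (by
          intro P' hP' hle
          have h1 := (hFI (Finset.mem_of_mem_erase hP')).2 (hFI hP).1 hle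
          exact Finset.ne_of_mem_erase hP' (le_antisymm h1 hle))
      obtain ⟨k, u, hu, huk⟩ := minimalPrime_pow (hFI hP) hxP
      refine ⟨x ^ (k + 1), fun _ => ⟨P.pow_mem_of_mem hxP _ (by omega), ?_, u, hu, ?_⟩⟩
      · intro P' hP' hne hmem
        exact hx P' (Finset.mem_erase.mpr ⟨hne, hP'⟩) ((hFp P' hP').mem_of_pow_mem _ hmem)
      · rw [pow_succ, ← mul_assoc]; exact I.mul_mem_right _ huk
    · exact ⟨0, fun h => absurd h hP⟩
  choose x hx using hx
  let C : Ideal R := Submodule.comap (LinearMap.mulLeft R (∏ P ∈ F, x P)) I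
  obtain ⟨c, hcC, hc⟩ := avoid F hFp C (by
    intro P hP hle
    obtain ⟨-, -, u, hu, hux⟩ := hx P hP
    apply hu
    apply hle
    change (∏ P ∈ F, x P) * u ∈ I
    rw [mul_comm]
    exact I.mem_of_dvd (mul_dvd_mul_left _ (Finset.dvd_prod_of_mem _ hP)) hux)
  have hcI : (∏ P ∈ F, x P) * c ∈ I := hcC
  obtain ⟨P0, hP0⟩ : F.Nonempty := Finset.card_pos.mp (by omega)
  have hP0p := hFp P0 hP0
  rcases absorb_finset h (F.erase P0) (by rw [Finset.card_erase_of_mem hP0]; omega) x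
    (c * x P0) (by rw [mul_assoc, Finset.mul_prod_erase _ _ hP0, mul_comm]; exact hcI)
    with h1 | ⟨k, hk, h1⟩
  · rw [one_mul] at h1
    have h2 := (hFI hP0).1.2 h1
    obtain ⟨P, hP, hP'⟩ := (Ideal.IsPrime.prod_mem_iff).mp h2
    have hPF := Finset.mem_of_mem_erase hP
    exact (hx P hPF).2.1 P0 hP0 (Finset.ne_of_mem_erase hP).symm hP'
  · rw [one_mul] at h1
    have hkF := Finset.mem_of_mem_erase hk
    have := hFp k hkF
    have h2 := (hFI hkF).1.2 h1
    rcases Ideal.IsPrime.mem_or_mem inferInstance h2 with h3 | h3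
    · rcases Ideal.IsPrime.mem_or_mem inferInstance h3 with h4 | h4
      · exact hc k hkF h4
      · exact (hx P0 hP0).2.1 k hkF (Finset.ne_of_mem_erase hk) h4
    · obtain ⟨P, hP, hP'⟩ := (Ideal.IsPrime.prod_mem_iff).mp h3
      have hPF := Finset.mem_of_mem_erase (Finset.mem_of_mem_erase hP)
      exact (hx P hPF).2.1 k hkF (Finset.ne_of_mem_erase hP).symm hP'

/-- The contraction of the localization of `I` at the prime `P`. -/
def contr (I P : Ideal R) (hP : P.IsPrime) : Ideal R where
  carrier := {x | ∃ u, u ∉ P ∧ u * x ∈ I}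
  zero_mem' := ⟨1, fun h => hP.ne_top ((Ideal.eq_top_iff_one P).mpr h), by simp⟩
  add_mem' := by
    rintro a b ⟨u, hu, hua⟩ ⟨v, hv, hvb⟩
    refine ⟨u * v, fun h => (hP.mem_or_mem h).elim hu hv, ?_⟩
    have : u * v * (a + b) = v * (u * a) + u * (v * b) := by ring
    rw [this]
    exact I.add_mem (I.mul_mem_left _ hua) (I.mul_mem_left _ hvb)
  smul_mem' := by
    rintro c a ⟨u, hu, hua⟩
    refine ⟨u, hu, ?_⟩
    have : u * (c • a) = c * (u * a) := by rw [smul_eq_mul]; ring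
    rw [this]
    exact I.mul_mem_left _ hua

theorem mem_contr {I P : Ideal R} {hP : P.IsPrime} {x : R} :
    x ∈ contr I P hP ↔ ∃ u, u ∉ P ∧ u * x ∈ I := Iff.rfl

theorem le_contr {I P : Ideal R} {hP : P.IsPrime} : I ≤ contr I P hP := fun x hx =>
  ⟨1, fun h => hP.ne_top ((Ideal.eq_top_iff_one P).mpr h), by simpa using hx⟩

theorem contr_le {I P : Ideal R} {hP : P.IsPrime} (hIP : I ≤ P) : contr I P hP ≤ P := by
  rintro x ⟨u, hu, hux⟩
  exact (hP.mem_or_mem (hIP hux)).resolve_left hu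

theorem contr_cancel {I P : Ideal R} {hP : P.IsPrime} {a b : R} (h : a * b ∈ contr I P hP)
    (hb : b ∉ P) : a ∈ contr I P hP := by
  obtain ⟨u, hu, hux⟩ := h
  refine ⟨u * b, fun h => (hP.mem_or_mem h).elim hu hb, ?_⟩
  have : u * b * a = u * (a * b) := by ring
  rw [this]; exact hux

theorem contr_absorbing {n : ℕ} {I P : Ideal R} {hP : P.IsPrime}
    (h : IsSNAbsorbingAssoc 1 n I) : IsSNAbsorbingAssoc 1 n (contr I P hP) := by
  classical
  rintro r ⟨u, hu, hur⟩
  rw [← Finset.mul_prod_erase univ r (mem_univ 0), ← mul_assoc] at hur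
  rcases absorb_finset h (univ.erase 0) (by simp) r _ hur with h1 | ⟨k, hk, h1⟩
  · exact ⟨0, le_contr h1⟩
  · refine ⟨k, u, hu, ?_⟩
    have h0 : (0 : Fin (n+1)) ∈ univ.erase k :=
      Finset.mem_erase.mpr ⟨(Finset.ne_of_mem_erase hk).symm, mem_univ _⟩
    rw [← Finset.mul_prod_erase _ r h0, Finset.erase_right_comm]
    rw [one_mul] at h1 ⊢
    rw [← mul_assoc]; exact h1

theorem radical_contr {I P : Ideal R} {hP : P.IsPrime} (hPI : P ∈ I.minimalPrimes) :
    (contr I P hP).radical = P := by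
  apply le_antisymm
  · exact hP.radical_le_iff.mpr (contr_le hPI.1.2)
  · intro x hx
    obtain ⟨k, u, hu, huk⟩ := minimalPrime_pow hPI hx
    exact ⟨k, u, hu, huk⟩

/-- In a locally divided ring an `n`-absorbing ideal is the intersection of its
minimal primary components. -/
theorem mem_of_forall_contr (hR : IsLocallyDivided R) {n : ℕ} (hn : 0 < n) {I : Ideal R}
    (h : IsSNAbsorbingAssoc 1 n I) (x : R)
    (hx : ∀ P, (hP : P ∈ I.minimalPrimes) → x ∈ contr I P hP.1.1) : x ∈ I := by
  classical
  by_contra hxI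
  let C : Ideal R := Submodule.comap (LinearMap.mulLeft R x) I
  have hC : C ≠ ⊤ := by
    intro hC
    have : (1 : R) ∈ C := hC ▸ Submodule.mem_top
    have : x * 1 ∈ I := this
    exact hxI (by simpa using this)
  obtain ⟨M, hM, hCM⟩ := Ideal.exists_le_maximal C hC
  have hMp : M.IsPrime := hM.isPrime
  have hIM : I ≤ M := fun z hz => hCM (show x * z ∈ I from I.mul_mem_left _ hz)
  obtain ⟨P, hP, hPM⟩ := Ideal.exists_minimalPrimes_le hIM
  have hPp := hP.1.1
  obtain ⟨u, hu, hux⟩ := hx P hP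
  have hxP : x ∈ P := contr_le (hP := hPp) hP.1.2 ⟨u, hu, hux⟩
  have hdisj : Disjoint (M.primeCompl : Set R) (P : Set R) := by
    rw [Set.disjoint_left]
    intro z hz hzP
    exact hz (hPM hzP)
  have hdiv := hR M hM (P.map (algebraMap R (Localization.AtPrime M)))
    (IsLocalization.isPrime_of_isPrime_disjoint M.primeCompl _ P hPp hdisj)
    (algebraMap R _ (u ^ (n - 1)))
  have hunder := IsLocalization.under_map_of_isPrime_disjoint M.primeCompl
    (Localization.AtPrime M) hPp hdisj
  rcases hdiv with h1 | h1
  · have h2 : u ^ (n - 1) ∈ P := by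
      rw [← hunder]; exact h1
    exact hu (hPp.mem_of_pow_mem _ h2)
  · have h2 := h1 (Ideal.mem_map_of_mem _ hxP)
    obtain ⟨z, hz⟩ := Ideal.mem_span_singleton'.mp h2
    obtain ⟨c, m, rfl⟩ := IsLocalization.exists_mk'_eq M.primeCompl z
    have h3 : algebraMap R (Localization.AtPrime M) (c * u ^ (n - 1)) =
        algebraMap R _ (m * x) := by
      rw [map_mul, map_mul, ← hz, ← mul_assoc, IsLocalization.mk'_spec']
    obtain ⟨v, hv⟩ := (IsLocalization.eq_iff_exists M.primeCompl _).mp h3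
    have h4 : (v * c) * u ^ n ∈ I := by
      have : (v * c : R) * u ^ n = (v * m) * (u * x) := by
        obtain ⟨k, rfl⟩ : ∃ k, n = k + 1 := ⟨n - 1, by omega⟩
        simp only [Nat.add_sub_cancel] at hv
        calc (v * c : R) * u ^ (k + 1) = u * (v * (c * u ^ k)) := by ring
          _ = _ := by rw [hv]; ring
      rw [this]; exact I.mul_mem_left _ hux
    rcases absorb_finset h (Finset.range n) (by simp) (fun _ => u) (v * c) (by simpa using h4)
      with h5 | ⟨k, hk, h5⟩
    · have h6 : u ^ n ∈ I := by simpa using h5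
      exact hu (hPp.mem_of_pow_mem _ (hP.1.2 h6))
    · rw [Finset.prod_const, Finset.card_erase_of_mem hk, Finset.card_range, one_mul,
        mul_assoc, hv] at h5
      have h6 : (v * m : R) ∈ C := by
        change x * (v * m) ∈ I
        have : x * (v * m : R) = v * (m * x) := by ring
        rw [this]; exact h5
      exact (v * m).2 (hCM h6)

/-- The saturated colon ideal of an `S`-`n`-absorbing ideal is `n`-absorbing. -/
theorem exists_colon (S : Submonoid R) {n : ℕ} (hn : 0 < n) {I : Ideal R}
    (hI : Disjoint (I : Set R) (S : Set R)) (h : IsSNAbsorbing (S : Set R) n I) :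
    ∃ σ ∈ S, ∃ J : Ideal R, (∀ x, x ∈ J ↔ σ * x ∈ I) ∧ IsSNAbsorbingAssoc 1 n J := by
  classical
  obtain ⟨s, hs, hab⟩ := h
  have hstab : ∀ x, s * (s ^ (2 * n - 1) * x) ∈ I → s ^ (2 * n - 1) * x ∈ I := by
    intro x hx
    obtain ⟨k, rfl⟩ : ∃ k, n = k + 1 := ⟨n - 1, by omega⟩
    have e : 2 * (k + 1) - 1 = 2 * k + 1 := by omega
    rw [e] at hx ⊢
    rcases absorb_finset hab (Finset.range (k + 1)) (by simp) (fun _ => s ^ 2) x (by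
      have : s * (s ^ (2 * k + 1) * x) = x * (s ^ 2) ^ (k + 1) := by ring
      rw [this] at hx
      simpa using hx) with h1 | ⟨j, hj, h1⟩
    · exfalso
      refine Set.disjoint_left.mp hI h1 ?_
      exact S.mul_mem hs (S.prod_mem fun _ _ => S.pow_mem hs _)
    · rw [Finset.prod_const, Finset.card_erase_of_mem hj, Finset.card_range] at h1
      have : s ^ (2 * k + 1) * x = s * (x * (s ^ 2) ^ (k + 1 - 1)) := by
        simp only [Nat.add_sub_cancel]; ring
      rw [this]; exact h1
  refine ⟨s ^ (2 * n - 1), S.pow_mem hs _,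
    Submodule.comap (LinearMap.mulLeft R (s ^ (2 * n - 1))) I, fun x => Iff.rfl, ?_⟩
  intro r hr
  have hr' : s ^ (2 * n - 1) * ∏ i, r i ∈ I := hr
  rw [← Finset.mul_prod_erase univ r (mem_univ 0), ← mul_assoc] at hr'
  rcases absorb_finset hab (univ.erase 0) (by simp) r _ hr' with h1 | ⟨k, hk, h1⟩
  · refine ⟨0, ?_⟩
    change s ^ (2 * n - 1) * _ ∈ I
    rw [one_mul]
    exact I.mem_of_dvd (mul_dvd_mul_right (dvd_pow_self s (by omega)) _) h1
  · refine ⟨k, ?_⟩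
    change s ^ (2 * n - 1) * _ ∈ I
    have h0 : (0 : Fin (n+1)) ∈ univ.erase k :=
      Finset.mem_erase.mpr ⟨(Finset.ne_of_mem_erase hk).symm, mem_univ _⟩
    rw [one_mul]
    apply hstab
    rw [← Finset.mul_prod_erase _ r h0, Finset.erase_right_comm, ← mul_assoc (s ^ _)]
    exact h1

theorem part_two (S : Submonoid R) (hR : IsLocallyDivided R)
    (hall : ∀ I : Ideal R, Disjoint (I : Set R) (S : Set R) →
        ∃ n : ℕ, 0 < n ∧ IsSNAbsorbing (S : Set R) n I) :
    IsStronglySLaskerian R (S : Set R) := by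
  classical
  intro I _ hI
  obtain ⟨n, hn, hab⟩ := hall I hI
  obtain ⟨σ, hσ, J, hJ, hJab⟩ := exists_colon S hn hI hab
  have hIJ : I ≤ J := fun x hx => (hJ x).mpr (I.mul_mem_left _ hx)
  have hfin : Finite J.minimalPrimes := finite_minimalPrimes hJab
  have : Fintype J.minimalPrimes := Fintype.ofFinite _
  let Q : J.minimalPrimes → Ideal R := fun P => contr J P.1 P.2.1.1
  have ht : ∀ P : J.minimalPrimes, ∃ t ∈ S, Disjoint (P.1 : Set R) (S : Set R) ∨ t ∈ Q P := by
    intro P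
    by_cases hd : Disjoint (P.1 : Set R) (S : Set R)
    · exact ⟨1, S.one_mem, Or.inl hd⟩
    · obtain ⟨t, htP, htS⟩ := Set.not_disjoint_iff.mp hd
      have : t ∈ (Q P).radical := by rw [radical_contr P.2]; exact htP
      obtain ⟨k, hk⟩ := this
      exact ⟨t ^ k, S.pow_mem htS k, Or.inr hk⟩
  choose t htS htQ using ht
  let T := ∏ P, t P
  have hTS : T ∈ S := S.prod_mem fun P _ => htS P
  let τ := σ * T
  have hτS : τ ∈ S := S.mul_mem hσ hTS
  let G := {P : J.minimalPrimes // Disjoint (P.1 : Set R) (S : Set R)}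
  let B : G → Ideal R := fun P => Q P.1 ⊓ (I ⊔ Ideal.span {τ})
  have key : ∀ r, (∀ P : G, r ∈ Q P.1) → τ * r ∈ I := by
    intro r hr
    have : T * r ∈ J := by
      refine mem_of_forall_contr hR hn hJab _ fun P hP => ?_
      by_cases hd : Disjoint (P : Set R) (S : Set R)
      · exact Ideal.mul_mem_left _ _ (hr ⟨⟨P, hP⟩, hd⟩)
      · have h1 := (htQ ⟨P, hP⟩).resolve_left hd
        exact Ideal.mul_mem_right _ _
          (Ideal.mem_of_dvd _ (Finset.dvd_prod_of_mem t (mem_univ ⟨P, hP⟩)) h1)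
    rw [mul_assoc]
    exact (hJ _).mp this
  have hτB : ∀ (P : G) (x : R), x ∈ Q P.1 → τ * x ∈ B P := by
    intro P x hx
    refine ⟨Ideal.mul_mem_left _ _ hx, ?_⟩
    exact Ideal.mem_sup_right (Ideal.mul_mem_right _ _ (Ideal.mem_span_singleton_self τ))
  have hIB : I = ⨅ P : G, B P := by
    apply le_antisymm
    · refine le_iInf fun P => le_inf (hIJ.trans le_contr) le_sup_left
    · intro x hx
      rw [Ideal.mem_iInf] at hx
      have hne : Nonempty G := by
        by_contra hemp
        rw [not_nonempty_iff] at hemp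
        have := key 1 (fun P => isEmptyElim P)
        exact Set.disjoint_left.mp hI this (by simpa using hτS)
      obtain ⟨P0⟩ := hne
      obtain ⟨i, hi, z, hz, rfl⟩ := Submodule.mem_sup.mp (hx P0).2
      obtain ⟨r, rfl⟩ := Ideal.mem_span_singleton.mp hz
      refine I.add_mem hi (key r fun P => ?_)
      have h1 : τ * r ∈ Q P.1 :=
        (Ideal.add_mem_iff_right _ ((hIJ.trans le_contr) hi)).mp (hx P).1
      rw [mul_comm] at h1
      exact contr_cancel h1 (fun h2 => Set.disjoint_left.mp P.2 h2 hτS)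
  have hB : ∀ P : G, IsStronglySPrimary (S : Set R) (B P) := by
    intro P
    have hPp := P.1.2.1.1
    have hrad : (Q P.1).radical = P.1.1 := radical_contr P.1.2
    refine ⟨⟨?_, τ, hτS, ?_⟩, ?_⟩
    · refine P.2.mono_left ?_
      intro x hx
      exact contr_le P.1.2.1.2 hx.1
    · intro a b hab
      by_cases hb : b ∈ P.1.1
      · right
        rw [← hrad] at hb
        obtain ⟨k, hk⟩ := hb
        refine ⟨k + 1, ?_⟩
        have : (τ * b) ^ (k + 1) = τ * (τ ^ k * b * b ^ k) := by ring
        rw [this]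
        exact hτB P _ (Ideal.mul_mem_left _ _ hk)
      · left
        exact hτB P _ (contr_cancel hab.1 hb)
    · obtain ⟨m, hm, hle⟩ := radical_pow_le (contr_absorbing (hP := hPp) hJab)
      refine ⟨m, τ, hm, hτS, fun x hx => hτB P _ (hle ?_)⟩
      exact Ideal.pow_right_mono (Ideal.radical_mono inf_le_left) m hx
  have : Finite G := Subtype.finite
  obtain ⟨m, ⟨e⟩⟩ := Finite.exists_equiv_fin G
  refine ⟨m, fun i => B (e.symm i), fun i => hB _, ?_⟩
  rw [hIB]
  exact (Equiv.iInf_comp (g := B) e.symm).symm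

theorem strongly_absorb (S : Submonoid R) {Q : Ideal R}
    (hQ : IsStronglySPrimary (S : Set R) Q) : ∃ u ∈ S, ∃ m : ℕ, ∀ (k : ℕ) (f : Fin k → R),
      ∏ i, f i ∈ Q → ∃ t : Finset (Fin k), t.card ≤ m ∧ u * ∏ i ∈ t, f i ∈ Q := by
  classical
  obtain ⟨⟨hd, s, hs, hp⟩, m, v, hm, hv, hvm⟩ := hQ
  have hprime : ∀ a b, s * (a * b) ∈ Q.radical → s * a ∈ Q.radical ∨ s * b ∈ Q.radical := by
    rintro a b ⟨k, hk⟩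
    have h1 : a ^ k * (s * b) ^ k ∈ Q := by
      have : a ^ k * (s * b) ^ k = (s * (a * b)) ^ k := by ring
      rw [this]; exact hk
    rcases hp _ _ h1 with h2 | h2
    · left
      refine ⟨k + 1, ?_⟩
      have : (s * a) ^ (k + 1) = (s ^ k * a) * (s * a ^ k) := by ring
      rw [this]; exact Q.mul_mem_left _ h2
    · right
      refine Ideal.mem_radical_of_pow_mem (m := k + 1) ?_
      have : (s * b) ^ (k + 1) = b * (s * (s * b) ^ k) := by ring
      rw [this]; exact Ideal.mul_mem_left _ _ h2
  have hprod : ∀ (k : ℕ) (f : Fin k → R) (t : Finset (Fin k)),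
      (∀ i ∈ t, s * f i ∉ Q.radical) → s * ∏ i ∈ t, f i ∉ Q.radical := by
    intro k f t
    induction t using Finset.induction_on with
    | empty =>
      rintro - ⟨j, hj⟩
      exact Set.disjoint_left.mp hd hj (by simpa using S.pow_mem hs j)
    | insert a t ha ih =>
      intro hall hmem
      rw [Finset.prod_insert ha] at hmem
      rcases hprime _ _ hmem with h1 | h1
      · exact hall a (Finset.mem_insert_self _ _) h1
      · exact ih (fun i hi => hall i (Finset.mem_insert_of_mem hi)) h1
  refine ⟨v * s ^ m, S.mul_mem hv (S.pow_mem hs m), m, fun k f hf => ?_⟩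
  by_cases hc : m ≤ (univ.filter (fun i => s * f i ∈ Q.radical)).card
  · obtain ⟨t, ht, htc⟩ := Finset.exists_subset_card_eq hc
    refine ⟨t, htc.le, ?_⟩
    have h1 : ∏ i ∈ t, (s * f i) ∈ ∏ i ∈ t, Q.radical :=
      Ideal.prod_mem_prod fun i hi => (Finset.mem_filter.mp (ht hi)).2
    rw [Finset.prod_const, htc] at h1
    have h2 := hvm _ h1
    rw [Finset.prod_mul_distrib, Finset.prod_const, htc, ← mul_assoc] at h2
    exact h2
  · refine ⟨univ.filter (fun i => s * f i ∈ Q.radical), by omega, ?_⟩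
    have h1 := hprod k f (univ.filter (fun i => ¬ s * f i ∈ Q.radical))
      (fun i hi => (Finset.mem_filter.mp hi).2)
    rw [← Finset.prod_filter_mul_prod_filter_not univ (fun i => s * f i ∈ Q.radical)] at hf
    have h2 := (hp _ _ hf).resolve_right h1
    exact Q.mem_of_dvd (mul_dvd_mul_right (Dvd.dvd.mul_left (dvd_pow_self s hm.ne') v) _) h2

theorem part_one (S : Submonoid R) (h : IsStronglySLaskerian R (S : Set R)) (I : Ideal R)
    (hI : Disjoint (I : Set R) (S : Set R)) :
    ∃ n : ℕ, 0 < n ∧ IsSNAbsorbing (S : Set R) n I := by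
  classical
  have hne : I ≠ ⊤ := by
    rintro rfl
    exact Set.disjoint_left.mp hI (Submodule.mem_top (x := (1 : R))) S.one_mem
  obtain ⟨m, Q, hQ, rfl⟩ := h I hne hI
  choose u hu M hM using fun i => strongly_absorb S (hQ i)
  refine ⟨∑ i, M i + 1, by omega, ∏ i, u i, S.prod_mem fun i _ => hu i, ?_⟩
  intro r hr
  rw [Ideal.mem_iInf] at hr
  choose t htc htp using fun i => hM i _ r (hr i)
  obtain ⟨j, hj⟩ : ∃ j, j ∉ univ.biUnion t := by
    by_contra! hcon
    have h1 : (univ.biUnion t).card ≤ ∑ i, M i :=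
      Finset.card_biUnion_le.trans (Finset.sum_le_sum fun i _ => htc i)
    have h2 : univ.biUnion t = univ := Finset.eq_univ_iff_forall.mpr hcon
    rw [h2, Finset.card_univ, Fintype.card_fin] at h1
    omega
  refine ⟨j, Ideal.mem_iInf.mpr fun i => ?_⟩
  refine (Q i).mem_of_dvd (mul_dvd_mul (Finset.dvd_prod_of_mem u (mem_univ i)) ?_) (htp i)
  refine Finset.prod_dvd_prod_of_subset _ _ _ fun x hx => ?_
  refine Finset.mem_erase.mpr ⟨?_, mem_univ _⟩
  rintro rfl
  exact hj (Finset.mem_biUnion.mpr ⟨i, mem_univ _, hx⟩)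

end SLask

theorem stmt_19 {R : Type*} [CommRing R] (S : Submonoid R) :
    (IsStronglySLaskerian R (S : Set R) →
      ∀ I : Ideal R, Disjoint (I : Set R) (S : Set R) →
        ∃ n : ℕ, 0 < n ∧ IsSNAbsorbing (S : Set R) n I) ∧
    (IsLocallyDivided R →
      (∀ I : Ideal R, Disjoint (I : Set R) (S : Set R) →
        ∃ n : ℕ, 0 < n ∧ IsSNAbsorbing (S : Set R) n I) →
      IsStronglySLaskerian R (S : Set R)) := by
  exact ⟨fun h I hI => SLask.part_one S h I hI, fun hR hall => SLask.part_two S hR hall⟩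
end
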